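/- Let h >= 0 and let (s,v,u,w) be a solution of the regularized blown-up system satisfying the energy relation with 0 <= s(tau) < 1 for all tau. Then exactly one of the following holds. (i) v(tau) < 0 for all tau, and there exists u_c in R with cos(u_c) nonzero and with the derivative of u |-> W(u)/cos(u)^2 vanishing at u_c, such that (s,v,u,w)(tau) converges to the equilibrium (0, -sqrt(2*W(u_c))/|cos(u_c)|, u_c, 0) as tau -> +infinity (forward triple collision). (ii) v(tau) > 0 for all tau, and the solution converges as tau -> -infinity to an equilibrium of the form (0, +sqrt(2*W(u_c))/|cos(u_c)|, u_c, 0) with u_c as in (i) (backward triple collision). (iii) There is a unique time tau0 with v(tau0) = 0; then v(tau) < 0 for tau < tau0 and v(tau) > 0 for tau > tau0, and either s is identically zero or s(tau) > 0 for all tau and s attains its minimum over R at tau0. -/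

import Mathlib

open Real Filter Topology MeasureTheory

/-- The regularized shape potential `W(u)` of the isosceles three-body problem with
masses `m1 = m2 = 1`, `m3`, where `mu = 2*m3/(2+m3)`. -/
noncomputable def Wpot (m3 u : ℝ) : ℝ :=
  1 / Real.sqrt 2 +
    2 * m3 * Real.cos u ^ 2 /
      Real.sqrt (Real.cos u ^ 4 / 2 + (1 - Real.cos u ^ 4) / (2 * m3 / (2 + m3)))

/-- The energy function `E(s,v,u,w)` for energy `h`. -/
noncomputable def energyFn (m3 h s v u w : ℝ) : ℝ :=
  1 / 2 * (v ^ 2 * Real.cos u ^ 2 + w ^ 2) - (1 - s) * Wpot m3 u - h * s * Real.cos u ^ 2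

/-- `(s,v,u,w) : ℝ → ℝ` is a (globally defined) solution of the regularized blown-up
system of the isosceles three-body problem with mass `m3` and energy `h`. -/
def IsSolution (m3 h : ℝ) (s v u w : ℝ → ℝ) : Prop :=
  (∀ τ : ℝ, HasDerivAt s (v τ * s τ * (1 - s τ) * Real.cos (u τ) ^ 2) τ) ∧
  (∀ τ : ℝ, HasDerivAt v (1 / 2 * (1 - s τ) * v τ ^ 2 * Real.cos (u τ) ^ 2 + w τ ^ 2
      - (1 - s τ) * Wpot m3 (u τ)) τ) ∧
  (∀ τ : ℝ, HasDerivAt u (1 / 2 * Real.sqrt (1 + Real.cos (u τ) ^ 2) * w τ) τ) ∧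
  (∀ τ : ℝ, HasDerivAt w (-(1 / 2) * (1 + s τ) * v τ * w τ * Real.cos (u τ) ^ 2
      + 1 / 2 * Real.sqrt (1 + Real.cos (u τ) ^ 2) * (1 - s τ) * deriv (Wpot m3) (u τ)
      + 1 / 2 * (v τ ^ 2 - 2 * h * s τ) * Real.sqrt (1 + Real.cos (u τ) ^ 2)
          * Real.sin (u τ) * Real.cos (u τ)) τ)

/-- The solution satisfies the energy relation `E = 0` at all times. -/
def SatisfiesEnergy (m3 h : ℝ) (s v u w : ℝ → ℝ) : Prop :=
  ∀ τ : ℝ, energyFn m3 h (s τ) (v τ) (u τ) (w τ) = 0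

lemma Wpot_radicand_pos {m3 : ℝ} (hm3 : 0 < m3) (x : ℝ) :
    0 < cos x ^ 4 / 2 + (1 - cos x ^ 4) / (2 * m3 / (2 + m3)) := by
  have h1 : cos x ^ 4 ≤ 1 := by
    nlinarith [cos_sq_le_one x, sq_nonneg (cos x)]
  have h0 : 0 ≤ cos x ^ 4 := by positivity
  have hμ : 0 < 2 * m3 / (2 + m3) := by positivity
  rcases h0.eq_or_lt with h | h
  · rw [← h]; simp; positivity
  · have : 0 ≤ (1 - cos x ^ 4) / (2 * m3 / (2 + m3)) := div_nonneg (by linarith) hμ.le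
    linarith

lemma Wpot_ge {m3 : ℝ} (hm3 : 0 < m3) (x : ℝ) : 1 / √2 ≤ Wpot m3 x := by
  unfold Wpot
  have : 0 ≤ 2 * m3 * cos x ^ 2 /
      √(cos x ^ 4 / 2 + (1 - cos x ^ 4) / (2 * m3 / (2 + m3))) := by positivity
  linarith

lemma Wpot_pos {m3 : ℝ} (hm3 : 0 < m3) (x : ℝ) : 0 < Wpot m3 x :=
  lt_of_lt_of_le (by positivity) (Wpot_ge hm3 x)

open scoped ContDiff in
lemma contDiff_Wpot {m3 : ℝ} (hm3 : 0 < m3) : ContDiff ℝ ω (Wpot m3) := by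
  have hc : ContDiff ℝ ω cos := contDiff_cos
  unfold Wpot
  refine contDiff_const.add (ContDiff.div (by fun_prop) (ContDiff.sqrt ?_ ?_) ?_)
  · simp only [div_eq_mul_inv]; fun_prop
  · exact fun x => (Wpot_radicand_pos hm3 x).ne'
  · exact fun x => (sqrt_pos.2 (Wpot_radicand_pos hm3 x)).ne'

lemma Wpot_periodic (m3 : ℝ) : Function.Periodic (Wpot m3) (2 * π) := by
  intro x; simp [Wpot]

lemma deriv_Wpot_periodic (m3 : ℝ) : Function.Periodic (deriv (Wpot m3)) (2 * π) := by
  intro x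
  rw [← deriv_comp_add_const]
  congr 1
  exact funext (Wpot_periodic m3)

/-- If the derivative of a convergent function is at most `-c * w ^ 2` and `w` is eventually
Lipschitz, then `w` tends to `0`. -/
lemma tendsto_zero_of_deriv_le_neg_sq {F F' w w' : ℝ → ℝ} {c C L : ℝ} (hc : 0 < c)
    (hF : ∀ t, HasDerivAt F (F' t) t) (hw : ∀ t, HasDerivAt w (w' t) t)
    (hFw : ∀ᶠ t in atTop, F' t ≤ -c * w t ^ 2) (hwC : ∀ᶠ t in atTop, |w' t| ≤ C)
    (hL : Tendsto F atTop (𝓝 L)) : Tendsto w atTop (𝓝 0) := by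
  obtain ⟨T, hT⟩ := eventually_atTop.1 (hFw.and hwC)
  have hC : 0 ≤ C := (abs_nonneg _).trans (hT T le_rfl).2
  rw [Metric.tendsto_atTop']
  intro ε hε
  set δ := ε / (2 * (C + 1)) with hδ
  have hδ0 : 0 < δ := by positivity
  have hCδ : C * δ < ε / 2 := by
    have : (C + 1) * δ = ε / 2 := by rw [hδ]; field_simp
    linarith
  have hD : Tendsto (fun t => F t - F (t + δ)) atTop (𝓝 0) := by
    simpa using hL.sub (hL.comp (tendsto_atTop_add_const_right atTop δ tendsto_id))
  have hpos : 0 < c * (ε / 2) ^ 2 * δ := by positivity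
  obtain ⟨N, hN⟩ := eventually_atTop.1 (hD.eventually_lt_const hpos)
  refine ⟨max T N, fun t ht => ?_⟩
  have htT : T < t := lt_of_le_of_lt (le_max_left _ _) ht
  have htN : N ≤ t := (lt_of_le_of_lt (le_max_right _ _) ht).le
  obtain ⟨ξ, ⟨hξ1, hξ2⟩, hξ⟩ := exists_hasDerivAt_eq_slope F F' (lt_add_of_pos_right t hδ0)
    (fun x _ => (hF x).continuousAt.continuousWithinAt) (fun x _ => hF x)
  obtain ⟨η, ⟨hη1, _⟩, hη⟩ := exists_hasDerivAt_eq_slope w w' hξ1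
    (fun x _ => (hw x).continuousAt.continuousWithinAt) (fun x _ => hw x)
  have h1 := (hT ξ (by linarith)).1
  have h2 := (hT η (by linarith)).2
  rw [add_sub_cancel_left, eq_div_iff hδ0.ne'] at hξ
  rw [eq_div_iff (by linarith)] at hη
  have h3 : w ξ ^ 2 < (ε / 2) ^ 2 := by
    by_contra! h
    have h4 : c * (ε / 2) ^ 2 ≤ c * w ξ ^ 2 := by gcongr
    have h5 : F' ξ * δ ≤ -(c * (ε / 2) ^ 2) * δ := by gcongr; linarith
    linarith [hN t htN]
  have h4 : |w ξ| < ε / 2 := abs_lt_of_sq_lt_sq h3 (by positivity)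
  have h5 : |w ξ - w t| ≤ C * δ := by
    rw [← hη, abs_mul, abs_of_pos (show 0 < ξ - t by linarith)]
    exact mul_le_mul h2 (by linarith) (by linarith) hC
  rw [Real.dist_eq, sub_zero]
  rw [abs_lt] at h4 ⊢
  rw [abs_le] at h5
  constructor <;> linarith

/-- A function whose derivative is eventually at most a negative constant does not converge. -/
lemma not_tendsto_of_deriv_le_neg {F F' : ℝ → ℝ} {c L : ℝ} (hc : 0 < c)
    (hF : ∀ t, HasDerivAt F (F' t) t) (h : ∀ᶠ t in atTop, F' t ≤ -c) :
    ¬ Tendsto F atTop (𝓝 L) := fun hL =>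
  one_ne_zero (tendsto_nhds_unique tendsto_const_nhds
    (tendsto_zero_of_deriv_le_neg_sq (w := fun _ => (1 : ℝ)) (w' := fun _ => 0) (C := 0) hc hF
      (fun t => hasDerivAt_const t 1) (by simpa using h) (by simp) hL))

/-- If a function and its derivative both converge, the derivative tends to `0`. -/
lemma tendsto_deriv_eq_zero {F F' : ℝ → ℝ} {l L : ℝ} (hF : ∀ t, HasDerivAt F (F' t) t)
    (hL : Tendsto F atTop (𝓝 L)) (hl : Tendsto F' atTop (𝓝 l)) : l = 0 := by
  by_contra hne
  have hpos : 0 < l ^ 2 / 2 := by positivity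
  have h1 : Tendsto (fun t => -l * F' t) atTop (𝓝 (-l * l)) := hl.const_mul _
  have h2 : ∀ᶠ t in atTop, -l * F' t ≤ -(l ^ 2 / 2) :=
    h1.eventually_le_const (by nlinarith)
  exact not_tendsto_of_deriv_le_neg hpos (fun t => (hF t).const_mul (-l)) h2 (hL.const_mul (-l))

/-- A function with positive derivative at each of its zeros is positive after a zero. -/
lemma pos_of_deriv_pos_of_eq_zero {f f' : ℝ → ℝ} (hf : ∀ t, HasDerivAt f (f' t) t)
    (hf' : ∀ t, f t = 0 → 0 < f' t) {a t : ℝ} (ha : f a = 0) (hat : a < t) : 0 < f t := by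
  have hnn : ∀ x, a ≤ x → 0 ≤ f x := fun x hx =>
    image_le_of_deriv_right_lt_deriv_boundary' (f := fun _ => 0) (f' := fun _ => 0) (b := x)
      continuousOn_const (fun y _ => hasDerivWithinAt_const y _ 0) ha.ge
      (fun y _ => (hf y).continuousAt.continuousWithinAt)
      (fun y _ => (hf y).hasDerivWithinAt) (fun y _ hy => hf' y hy.symm) ⟨hx, le_rfl⟩
  refine (hnn t hat.le).lt_of_ne' fun h0 => ?_
  have hmin : IsLocalMin f t := by
    filter_upwards [eventually_gt_nhds hat] with x hx
    rw [h0]; exact hnn x hx.le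
  exact (hf' t h0).ne' (hmin.hasDerivAt_eq_zero (hf t))

/-- A solution of `f' = g * f` with continuous `g` is a positive multiple of its initial value. -/
lemma exists_pos_mul_of_deriv_eq_mul {f g : ℝ → ℝ} (hg : Continuous g)
    (hf : ∀ t, HasDerivAt f (g t * f t) t) (a t : ℝ) : ∃ k : ℝ, 0 < k ∧ f t = k * f a := by
  set A : ℝ → ℝ := fun x => ∫ y in a..x, g y with hA
  have hA' : ∀ x, HasDerivAt A (g x) x := fun x => hg.integral_hasStrictDerivAt a x |>.hasDerivAt
  have hd : ∀ x, HasDerivAt (fun x => f x * exp (-A x)) 0 x := fun x => by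
    exact ((hf x).fun_mul (hA' x).fun_neg.exp).congr_deriv (by ring)
  have h := is_const_of_deriv_eq_zero (fun x => (hd x).differentiableAt) (fun x => (hd x).deriv) t a
  have hAa : A a = 0 := by simp [hA]
  simp only [hAa, neg_zero, exp_zero, mul_one] at h
  refine ⟨exp (A t), exp_pos _, ?_⟩
  rw [← h, mul_comm, mul_assoc, ← exp_add]; simp

/-- A continuous function on a half line along which `cos` has no zero is bounded. -/
lemma exists_bound_of_cos_ne_zero {u : ℝ → ℝ} (hu : Continuous u) {T : ℝ}
    (h : ∀ t, T ≤ t → cos (u t) ≠ 0) : ∀ t, T ≤ t → |u t - u T| ≤ π := by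
  intro t ht
  by_contra! hlt
  have hconn : IsPreconnected (u '' Set.Ici T) := isPreconnected_Ici.image _ hu.continuousOn
  have hconn' : IsPreconnected (cos '' (u '' Set.Ici T)) := hconn.image _ continuous_cos.continuousOn
  have hT : u T ∈ u '' Set.Ici T := ⟨T, Set.self_mem_Ici, rfl⟩
  have htm : u t ∈ u '' Set.Ici T := ⟨t, ht, rfl⟩
  have hcos : ∃ y ∈ u '' Set.Ici T, cos y = -cos (u T) := by
    rcases lt_abs.1 hlt with h1 | h1
    · exact ⟨u T + π, hconn.Icc_subset hT htm ⟨by linarith [pi_pos], by linarith⟩, cos_add_pi _⟩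
    · exact ⟨u T - π, hconn.Icc_subset htm hT ⟨by linarith, by linarith [pi_pos]⟩, cos_sub_pi _⟩
  obtain ⟨y, hy, hyc⟩ := hcos
  have h1 : cos (u T) ∈ cos '' (u '' Set.Ici T) := ⟨_, hT, rfl⟩
  have h2 : -cos (u T) ∈ cos '' (u '' Set.Ici T) := ⟨y, hy, hyc⟩
  have h0 : (0 : ℝ) ∈ cos '' (u '' Set.Ici T) := by
    rcases le_total 0 (cos (u T)) with hp | hp
    · exact hconn'.Icc_subset h2 h1 ⟨by linarith, hp⟩
    · exact hconn'.Icc_subset h1 h2 ⟨hp, by linarith⟩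
  obtain ⟨_, ⟨r, hr, rfl⟩, hr0⟩ := h0
  exact h r hr hr0

/-- If `G` is analytic and not identically zero, a bounded continuous curve along which `G` tends
to `0` converges. -/
lemma exists_tendsto_of_analytic_tendsto_zero {G u : ℝ → ℝ} (hG : AnalyticOnNhd ℝ G Set.univ)
    {z : ℝ} (hz : G z ≠ 0) (hu : Continuous u) {B : ℝ} (hB : ∀ᶠ t in atTop, |u t| ≤ B)
    (h : Tendsto (fun t => G (u t)) atTop (𝓝 0)) : ∃ l, Tendsto u atTop (𝓝 l) := by
  refine tendsto_of_no_upcrossings dense_univ ?_ ⟨B, ?_⟩ ⟨-B, ?_⟩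
  · rintro a - b - hab ⟨ha, hb⟩
    have hzero : ∀ y ∈ Set.Ioo a b, G y = 0 := by
      intro y hy
      have hfr : ∃ᶠ t in atTop, u t = y := by
        rw [frequently_atTop] at ha hb ⊢
        intro N
        obtain ⟨p, hp, hpa⟩ := ha N
        obtain ⟨q, hq, hqb⟩ := hb N
        obtain ⟨r, hr, hry⟩ := (isPreconnected_Ici.image u hu.continuousOn).Icc_subset
          ⟨p, Set.mem_Ici.2 hp, rfl⟩ ⟨q, Set.mem_Ici.2 hq, rfl⟩
          ⟨(hpa.trans hy.1).le, (hy.2.trans hqb).le⟩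
        exact ⟨r, hr, hry⟩
      by_contra hne
      have hev : ∀ᶠ t in atTop, G (u t) ≠ G y := h.eventually_ne (Ne.symm hne)
      obtain ⟨t, h1, h2⟩ := (hfr.and_eventually hev).exists
      exact h2 (by rw [h1])
    have hmid : (a + b) / 2 ∈ Set.Ioo a b := ⟨by linarith, by linarith⟩
    have hG0 : G =ᶠ[𝓝 ((a + b) / 2)] fun _ => 0 := by
      filter_upwards [Ioo_mem_nhds hmid.1 hmid.2] with y hy using hzero y hy
    exact hz (congrFun (hG.eq_of_eventuallyEq analyticOnNhd_const hG0) z)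
  · exact eventually_map.2 (hB.mono fun t ht => (abs_le.1 ht).2)
  · exact eventually_map.2 (hB.mono fun t ht => (abs_le.1 ht).1)
lemma exists_bound_Wpot {m3 : ℝ} (hm3 : 0 < m3) :
    ∃ M : ℝ, ∀ x, Wpot m3 x ≤ M ∧ |deriv (Wpot m3) x| ≤ M := by
  have hW := contDiff_Wpot hm3
  obtain ⟨M₁, h₁⟩ := isBounded_iff_forall_norm_le.1
    ((Wpot_periodic m3).isBounded_of_continuous two_pi_pos.ne' hW.continuous)
  obtain ⟨M₂, h₂⟩ := isBounded_iff_forall_norm_le.1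
    ((deriv_Wpot_periodic m3).isBounded_of_continuous two_pi_pos.ne'
      (hW.continuous_deriv (by simp)))
  exact ⟨max M₁ M₂, fun x =>
    ⟨(le_abs_self _).trans ((h₁ _ ⟨x, rfl⟩).trans (le_max_left _ _)),
      (h₂ _ ⟨x, rfl⟩).trans (le_max_right _ _)⟩⟩

lemma deriv_Wpot_div_cos_sq {m3 : ℝ} (hm3 : 0 < m3) {x : ℝ} (hx : cos x ≠ 0) :
    deriv (fun y => Wpot m3 y / cos y ^ 2) x =
      (deriv (Wpot m3) x + 2 * Wpot m3 x / cos x ^ 2 * sin x * cos x) / cos x ^ 2 := by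
  have hW : HasDerivAt (Wpot m3) (deriv (Wpot m3) x) x :=
    ((contDiff_Wpot hm3).differentiable (by simp) x).hasDerivAt
  have h := hW.fun_div ((hasDerivAt_cos x).fun_pow 2) (pow_ne_zero 2 hx)
  rw [h.deriv]
  field_simp
  simp
  ring

/-- The time reversal `(s, v, u, w)(τ) ↦ (s, -v, u, -w)(-τ)` preserves solutions. -/
lemma IsSolution.reverse {m3 h : ℝ} {s v u w : ℝ → ℝ} (hsol : IsSolution m3 h s v u w) :
    IsSolution m3 h (fun τ => s (-τ)) (fun τ => -v (-τ)) (fun τ => u (-τ))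
      (fun τ => -w (-τ)) := by
  obtain ⟨hs, hv, hu, hw⟩ := hsol
  refine ⟨fun τ => ?_, fun τ => ?_, fun τ => ?_, fun τ => ?_⟩
  · exact ((hs (-τ)).comp τ (hasDerivAt_neg τ)).congr_deriv (by ring)
  · exact ((hv (-τ)).comp τ (hasDerivAt_neg τ)).fun_neg.congr_deriv (by ring)
  · exact ((hu (-τ)).comp τ (hasDerivAt_neg τ)).congr_deriv (by ring)
  · exact ((hw (-τ)).comp τ (hasDerivAt_neg τ)).fun_neg.congr_deriv (by ring)

lemma SatisfiesEnergy.reverse {m3 h : ℝ} {s v u w : ℝ → ℝ} (hE : SatisfiesEnergy m3 h s v u w) :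
    SatisfiesEnergy m3 h (fun τ => s (-τ)) (fun τ => -v (-τ)) (fun τ => u (-τ))
      (fun τ => -w (-τ)) := fun τ => by
  simpa [energyFn] using hE (-τ)

/-- A solution on the energy level that has `v < 0` at all times tends to triple collision. -/
lemma forward_triple_collision {m3 h : ℝ} (hm3 : 0 < m3) (hh : 0 ≤ h) {s v u w : ℝ → ℝ}
    (hsol : IsSolution m3 h s v u w) (hE : SatisfiesEnergy m3 h s v u w)
    (hs : ∀ τ : ℝ, 0 ≤ s τ ∧ s τ < 1) (hv : ∀ τ, v τ < 0) :
    ∃ uc : ℝ, cos uc ≠ 0 ∧ deriv (fun x => Wpot m3 x / cos x ^ 2) uc = 0 ∧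
      Tendsto (fun τ => (s τ, v τ, u τ, w τ)) atTop
        (𝓝 ((0 : ℝ), -√(2 * Wpot m3 uc) / |cos uc|, uc, (0 : ℝ))) := by
  obtain ⟨ds, dv, du, dw⟩ := hsol
  obtain ⟨M, hM⟩ := exists_bound_Wpot hm3
  have hW0 := Wpot_pos hm3
  have hc0 : ∀ τ, 0 ≤ cos (u τ) ^ 2 := fun τ => sq_nonneg _
  have hc1 : ∀ τ, cos (u τ) ^ 2 ≤ 1 := fun τ => cos_sq_le_one _
  have hM0 : 0 ≤ M := (hW0 0).le.trans (hM 0).1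
  have hen : ∀ τ, 1 / 2 * (v τ ^ 2 * cos (u τ) ^ 2 + w τ ^ 2) =
      (1 - s τ) * Wpot m3 (u τ) + h * s τ * cos (u τ) ^ 2 := fun τ => by
    have := hE τ; unfold energyFn at this; linarith
  have hcu : Continuous u := continuous_iff_continuousAt.2 fun τ => (du τ).continuousAt
  -- `s` decreases to a limit below `1`
  have hsanti : Antitone s := antitone_of_hasDerivAt_nonpos ds fun τ => by
    have h1 : 0 ≤ s τ * (1 - s τ) * cos (u τ) ^ 2 :=
      mul_nonneg (mul_nonneg (hs τ).1 (by linarith [(hs τ).2])) (hc0 τ)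
    show v τ * s τ * (1 - s τ) * cos (u τ) ^ 2 ≤ 0
    nlinarith [hv τ]
  obtain ⟨σ, hσ⟩ : ∃ σ, Tendsto s atTop (𝓝 σ) :=
    ⟨_, tendsto_atTop_ciInf hsanti ⟨0, by rintro _ ⟨τ, rfl⟩; exact (hs τ).1⟩⟩
  have hs0 : ∀ τ, 0 ≤ τ → s τ ≤ s 0 := fun τ hτ => hsanti hτ
  set κ := 1 - s 0 with hκ
  have hκ0 : 0 < κ := by have := (hs 0).2; linarith
  have hsκ : ∀ τ, 0 ≤ τ → κ ≤ 1 - s τ := fun τ hτ => by linarith [hs0 τ hτ]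
  have hsd : ∀ τ, 0 < 1 - s τ := fun τ => by linarith [(hs τ).2]
  -- a monotone quantity
  set F : ℝ → ℝ := fun τ => (v τ ^ 2 - 2 * h) / (1 - s τ) with hFdef
  have dF : ∀ τ, HasDerivAt F (v τ * w τ ^ 2 / (1 - s τ)) τ := fun τ => by
    have h1 := (((dv τ).fun_pow 2).sub_const (2 * h)).fun_div ((ds τ).const_sub 1) (hsd τ).ne'
    refine h1.congr_deriv ?_
    have h2 : w τ ^ 2 = 2 * (1 - s τ) * Wpot m3 (u τ) + 2 * h * s τ * cos (u τ) ^ 2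
        - v τ ^ 2 * cos (u τ) ^ 2 := by linarith [hen τ]
    have := (hsd τ).ne'
    rw [h2]
    field_simp
    ring
  have hFanti : Antitone F := antitone_of_hasDerivAt_nonpos dF fun τ =>
    div_nonpos_of_nonpos_of_nonneg (mul_nonpos_of_nonpos_of_nonneg (hv τ).le (sq_nonneg _))
      (hsd τ).le
  have hFlb : ∀ τ, 0 ≤ τ → -(2 * h) / κ ≤ F τ := fun τ hτ => by
    rw [hFdef, div_le_div_iff₀ hκ0 (hsd τ)]
    nlinarith [hsκ τ hτ, sq_nonneg (v τ), mul_nonneg (sq_nonneg (v τ)) hκ0.le]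
  obtain ⟨φ, hφ⟩ : ∃ φ, Tendsto F atTop (𝓝 φ) := by
    rcases tendsto_atTop_of_antitone hFanti with hbot | hlim
    · obtain ⟨τ, h1, h2⟩ := ((hbot.eventually_lt_atBot (-(2 * h) / κ)).and
        (eventually_ge_atTop 0)).exists
      exact absurd (hFlb τ h2) (not_le.2 h1)
    · exact hlim
  -- hence `v` converges
  have hvF : ∀ τ, v τ ^ 2 = 2 * h + F τ * (1 - s τ) := fun τ => by
    rw [hFdef]; field_simp [(hsd τ).ne']; ring
  have hvsqrt : ∀ τ, v τ = -√(2 * h + F τ * (1 - s τ)) := fun τ => by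
    rw [← hvF, sqrt_sq_eq_abs, abs_of_neg (hv τ), neg_neg]
  obtain ⟨ν, hν⟩ : ∃ ν, Tendsto v atTop (𝓝 ν) :=
    ⟨_, (((hφ.mul (hσ.const_sub 1)).const_add (2 * h)).sqrt.neg).congr fun τ => (hvsqrt τ).symm⟩
  have hν_nonpos : ν ≤ 0 := le_of_tendsto' hν fun τ => (hv τ).le
  have hr0 : 0 < κ * (1 / √2) := by positivity
  have hWκ : ∀ τ, 0 ≤ τ → κ * (1 / √2) ≤ (1 - s τ) * Wpot m3 (u τ) := fun τ hτ =>
    mul_le_mul (hsκ τ hτ) (Wpot_ge hm3 _) (by positivity) (hsd τ).le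
  have hν0 : ν < 0 := by
    refine hν_nonpos.lt_of_ne fun h0 => ?_
    rw [h0] at hν
    have hv2 : ∀ᶠ τ in atTop, v τ ^ 2 < κ * (1 / √2) / 2 :=
      (hν.pow 2).eventually_lt_const (by simpa using half_pos hr0)
    refine not_tendsto_of_deriv_le_neg (half_pos hr0) (fun τ => (dv τ).fun_neg) ?_ hν.neg
    filter_upwards [hv2, eventually_ge_atTop 0] with τ h1 h2
    have h3 : s τ * (v τ ^ 2 * cos (u τ) ^ 2) ≤ 1 * (v τ ^ 2 * 1) :=
      mul_le_mul (hs τ).2.le (mul_le_mul_of_nonneg_left (hc1 τ) (sq_nonneg _))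
        (mul_nonneg (sq_nonneg _) (hc0 τ)) zero_le_one
    have h4 : v τ ^ 2 * cos (u τ) ^ 2 ≤ v τ ^ 2 * 1 :=
      mul_le_mul_of_nonneg_left (hc1 τ) (sq_nonneg _)
    have h5 : 0 ≤ h * s τ * cos (u τ) ^ 2 := mul_nonneg (mul_nonneg hh (hs τ).1) (hc0 τ)
    linarith [hen τ, hWκ τ h2]
  have hvneg : ∀ᶠ τ in atTop, v τ ≤ ν / 2 := hν.eventually_le_const (by linarith)
  have hvlb : ∀ᶠ τ in atTop, |v τ| ≤ |ν| + 1 := hν.abs.eventually_le_const (by linarith)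
  -- bounds on `w` and its derivative
  have hwb : ∀ τ, |w τ| ≤ 2 * (M + h) + 1 := fun τ => by
    have h1 : (1 - s τ) * Wpot m3 (u τ) ≤ 1 * M :=
      mul_le_mul (by linarith [(hs τ).1]) (hM _).1 (hW0 _).le zero_le_one
    have h2 : h * s τ * cos (u τ) ^ 2 ≤ h * 1 * 1 :=
      mul_le_mul (mul_le_mul_of_nonneg_left (hs τ).2.le hh) (hc1 τ) (hc0 τ) (by linarith)
    have h3 : 0 ≤ v τ ^ 2 * cos (u τ) ^ 2 := mul_nonneg (sq_nonneg _) (hc0 τ)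
    have h4 := hen τ
    have h5 : |w τ| ^ 2 ≤ 2 * (M + h) := by rw [sq_abs]; linarith
    nlinarith [sq_nonneg (|w τ| - 1)]
  have hr2 : ∀ τ, √(1 + cos (u τ) ^ 2) ≤ 2 := fun τ => by
    rw [sqrt_le_left (by norm_num)]; linarith [hc1 τ]
  have hw0 : Tendsto w atTop (𝓝 0) := by
    refine tendsto_zero_of_deriv_le_neg_sq (c := -ν / 2)
      (C := (|ν| + 1) * (2 * (M + h) + 1) + M + ((|ν| + 1) ^ 2 + 2 * h))
      (by linarith) dF dw ?_ ?_ hφ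
    · filter_upwards [hvneg] with τ h1
      rw [div_le_iff₀ (hsd τ)]
      have h2 : v τ * w τ ^ 2 ≤ ν / 2 * w τ ^ 2 := mul_le_mul_of_nonneg_right h1 (sq_nonneg _)
      have h3 : -ν * w τ ^ 2 * (1 - s τ) ≤ -ν * w τ ^ 2 * 1 :=
        mul_le_mul_of_nonneg_left (by linarith [(hs τ).1])
          (mul_nonneg (by linarith) (sq_nonneg _))
      linarith
    · filter_upwards [hvlb] with τ h1
      have hs1 : |1 - s τ| ≤ 1 := by rw [abs_of_pos (hsd τ)]; linarith [(hs τ).1]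
      have hs2 : |1 + s τ| ≤ 2 := by
        rw [abs_of_nonneg (by linarith [(hs τ).1])]; linarith [(hs τ).2]
      have hR : |√(1 + cos (u τ) ^ 2)| ≤ 2 := by rw [abs_of_nonneg (sqrt_nonneg _)]; exact hr2 τ
      have hcc : |cos (u τ) ^ 2| ≤ 1 := by rw [abs_of_nonneg (hc0 τ)]; exact hc1 τ
      have hQ : |v τ ^ 2 - 2 * h * s τ| ≤ (|ν| + 1) ^ 2 + 2 * h := by
        have h2 : v τ ^ 2 ≤ (|ν| + 1) ^ 2 := by
          rw [← sq_abs (v τ)]; gcongr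
        have h3 : h * s τ ≤ h * 1 := mul_le_mul_of_nonneg_left (hs τ).2.le hh
        have h4 : 0 ≤ h * s τ := mul_nonneg hh (hs τ).1
        rw [abs_le]
        constructor <;> nlinarith [sq_nonneg (v τ), sq_nonneg (|ν| + 1)]
      refine (abs_add_le _ _).trans (add_le_add ((abs_add_le _ _).trans (add_le_add ?_ ?_)) ?_)
      · simp only [abs_mul]
        calc |(-(1 / 2) : ℝ)| * |1 + s τ| * |v τ| * |w τ| * |cos (u τ) ^ 2|
            ≤ |(-(1 / 2) : ℝ)| * 2 * (|ν| + 1) * (2 * (M + h) + 1) * 1 := by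
              gcongr; exact hwb τ
          _ = _ := by norm_num
      · simp only [abs_mul]
        calc |(1 / 2 : ℝ)| * |√(1 + cos (u τ) ^ 2)| * |1 - s τ| * |deriv (Wpot m3) (u τ)|
            ≤ |(1 / 2 : ℝ)| * 2 * 1 * M := by gcongr; exact (hM _).2
          _ = _ := by norm_num
      · simp only [abs_mul]
        calc |(1 / 2 : ℝ)| * |v τ ^ 2 - 2 * h * s τ| * |√(1 + cos (u τ) ^ 2)| * |sin (u τ)|
              * |cos (u τ)|
            ≤ |(1 / 2 : ℝ)| * ((|ν| + 1) ^ 2 + 2 * h) * 2 * 1 * 1 := by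
              gcongr
              · exact abs_sin_le_one _
              · exact abs_cos_le_one _
          _ = _ := by norm_num; ring
  -- `cos u` stays away from `0`
  set δ := κ * (1 / √2) / (|ν| + 1) ^ 2 with hδ
  have hδ0 : 0 < δ := by positivity
  have hcδ : ∀ᶠ τ in atTop, δ ≤ cos (u τ) ^ 2 := by
    have hw2 : ∀ᶠ τ in atTop, w τ ^ 2 < κ * (1 / √2) :=
      (hw0.pow 2).eventually_lt_const (by simpa using hr0)
    filter_upwards [hw2, hvlb, eventually_ge_atTop 0] with τ h1 h2 h3
    rw [hδ, div_le_iff₀ (by positivity)]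
    have h4 : v τ ^ 2 ≤ (|ν| + 1) ^ 2 := by rw [← sq_abs (v τ)]; gcongr
    have h5 : cos (u τ) ^ 2 * v τ ^ 2 ≤ cos (u τ) ^ 2 * (|ν| + 1) ^ 2 :=
      mul_le_mul_of_nonneg_left h4 (hc0 τ)
    have h6 : 0 ≤ h * s τ * cos (u τ) ^ 2 := mul_nonneg (mul_nonneg hh (hs τ).1) (hc0 τ)
    linarith [hen τ, hWκ τ h3]
  -- hence `s` tends to `0`
  have hslim : Tendsto s atTop (𝓝 0) := by
    refine tendsto_zero_of_deriv_le_neg_sq (c := -ν / 2 * κ * δ) (C := |ν| + 1) ?_ ds ds ?_ ?_ hσ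
    · have : 0 < -ν / 2 := by linarith
      positivity
    · filter_upwards [hvneg, hcδ, eventually_ge_atTop 0] with τ h1 h2 h3
      have h4 : -ν / 2 * s τ * κ * δ ≤ -v τ * s τ * (1 - s τ) * cos (u τ) ^ 2 := by
        have := (hs τ).1
        have := hsκ τ h3
        have := hsd τ
        have : 0 ≤ -v τ := by linarith [hv τ]
        gcongr
        linarith
      have h5 : s τ ^ 2 ≤ s τ := by nlinarith [(hs τ).1, (hs τ).2]
      have h6 : -ν / 2 * κ * δ * s τ ^ 2 ≤ -ν / 2 * κ * δ * s τ := by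
        have : 0 < -ν / 2 := by linarith
        gcongr
      linarith
    · filter_upwards [hvlb] with τ h1
      have hs1 : |1 - s τ| ≤ 1 := by rw [abs_of_pos (hsd τ)]; linarith [(hs τ).1]
      have hs2 : |s τ| ≤ 1 := by rw [abs_of_nonneg (hs τ).1]; exact (hs τ).2.le
      have hcc : |cos (u τ) ^ 2| ≤ 1 := by rw [abs_of_nonneg (hc0 τ)]; exact hc1 τ
      simp only [abs_mul]
      calc |v τ| * |s τ| * |1 - s τ| * |cos (u τ) ^ 2| ≤ (|ν| + 1) * 1 * 1 * 1 := by gcongr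
        _ = _ := by ring
  -- `u` converges to a zero of an analytic function
  set G : ℝ → ℝ := fun x => 1 / 2 * ν ^ 2 * cos x ^ 2 - Wpot m3 x with hG
  have hGan : AnalyticOnNhd ℝ G Set.univ := by
    have h1 : ContDiff ℝ ⊤ cos := contDiff_cos
    have h2 := contDiff_Wpot hm3
    exact ContDiff.analyticOnNhd (by rw [hG]; fun_prop)
  have hGlim : Tendsto (fun τ => G (u τ)) atTop (𝓝 0) := by
    have hb : Tendsto (fun τ => 1 / 2 * |ν ^ 2 - v τ ^ 2| + s τ * (M + h) + 1 / 2 * w τ ^ 2)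
        atTop (𝓝 0) := by
      have := (((hν.pow 2).const_sub (ν ^ 2)).abs.const_mul (1 / 2)).add
        (hslim.mul_const (M + h)) |>.add ((hw0.pow 2).const_mul (1 / 2))
      simpa using this
    refine squeeze_zero_norm (fun τ => ?_) hb
    have h1 : G (u τ) = 1 / 2 * ((ν ^ 2 - v τ ^ 2) * cos (u τ) ^ 2)
        + s τ * (h * cos (u τ) ^ 2 - Wpot m3 (u τ)) - 1 / 2 * w τ ^ 2 := by
      simp only [hG]; linarith [hen τ]
    have h2 : |(ν ^ 2 - v τ ^ 2) * cos (u τ) ^ 2| ≤ |ν ^ 2 - v τ ^ 2| := by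
      rw [abs_mul, abs_of_nonneg (hc0 τ)]
      exact mul_le_of_le_one_right (abs_nonneg _) (hc1 τ)
    have h3 : |s τ * (h * cos (u τ) ^ 2 - Wpot m3 (u τ))| ≤ s τ * (M + h) := by
      rw [abs_mul, abs_of_nonneg (hs τ).1]
      refine mul_le_mul_of_nonneg_left ?_ (hs τ).1
      have h4 : h * cos (u τ) ^ 2 ≤ h * 1 := mul_le_mul_of_nonneg_left (hc1 τ) hh
      have h5 := mul_nonneg hh (hc0 τ)
      rw [abs_le]
      constructor <;> linarith [(hM (u τ)).1, hW0 (u τ)]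
    rw [Real.norm_eq_abs, h1]
    rw [abs_le] at h2 h3 ⊢
    constructor <;> linarith [sq_nonneg (w τ), abs_nonneg (ν ^ 2 - v τ ^ 2)]
  obtain ⟨T, hT⟩ := eventually_atTop.1 hcδ
  have hub : ∀ᶠ τ in atTop, |u τ| ≤ |u T| + π := by
    filter_upwards [eventually_ge_atTop T] with τ hτ
    have h1 := exists_bound_of_cos_ne_zero hcu (T := T)
      (fun t ht h0 => by have := hT t ht; rw [h0] at this; norm_num at this; linarith) τ hτ
    linarith [abs_sub_abs_le_abs_sub (u τ) (u T)]
  obtain ⟨uc, huc⟩ := exists_tendsto_of_analytic_tendsto_zero hGan (z := π / 2)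
    (by simpa [hG] using (hW0 _).ne') hcu hub hGlim
  have hG0 : G uc = 0 :=
    tendsto_nhds_unique ((hGan uc (Set.mem_univ _)).continuousAt.tendsto.comp huc) hGlim
  have hcuc : cos uc ≠ 0 := fun h0 => by
    simp only [hG, h0] at hG0
    linarith [hW0 uc]
  have hν2 : ν ^ 2 = 2 * Wpot m3 uc / cos uc ^ 2 := by
    rw [eq_div_iff (pow_ne_zero 2 hcuc)]
    simp only [hG] at hG0
    linarith
  have hνeq : ν = -√(2 * Wpot m3 uc) / |cos uc| := by
    rw [neg_div, ← sqrt_sq_eq_abs, ← sqrt_div (by linarith [hW0 uc]), ← hν2, sqrt_sq_eq_abs,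
      abs_of_neg hν0, neg_neg]
  refine ⟨uc, hcuc, ?_, ?_⟩
  · have hcos : Tendsto (fun τ => cos (u τ)) atTop (𝓝 (cos uc)) :=
      (continuous_cos.tendsto uc).comp huc
    have hsin : Tendsto (fun τ => sin (u τ)) atTop (𝓝 (sin uc)) :=
      (continuous_sin.tendsto uc).comp huc
    have hdW : Tendsto (fun τ => deriv (Wpot m3) (u τ)) atTop (𝓝 (deriv (Wpot m3) uc)) :=
      (((contDiff_Wpot hm3).continuous_deriv (by simp)).tendsto uc).comp huc
    have hroot := ((hcos.pow 2).const_add 1).sqrt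
    have hlim := (((((hslim.const_add 1).const_mul (-(1 / 2))).mul hν).mul hw0).mul
      (hcos.pow 2)).add (((hroot.const_mul (1 / 2)).mul (hslim.const_sub 1)).mul hdW) |>.add
      ((((((hν.pow 2).sub (hslim.const_mul (2 * h))).const_mul (1 / 2)).mul hroot).mul hsin).mul
        hcos)
    have h0 := tendsto_deriv_eq_zero dw hw0 hlim
    have hrpos : 0 < √(1 + cos uc ^ 2) := by positivity
    have h1 : √(1 + cos uc ^ 2) * (deriv (Wpot m3) uc + ν ^ 2 * sin uc * cos uc) = 0 := by
      linarith
    rw [deriv_Wpot_div_cos_sq hm3 hcuc, ← hν2, (mul_eq_zero.1 h1).resolve_left hrpos.ne', zero_div]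
  · rw [← hνeq]
    exact hslim.prodMk_nhds (hν.prodMk_nhds (huc.prodMk_nhds hw0))

/-- trichotomy for solutions on the energy level with `h ≥ 0` and
`0 ≤ s < 1`: (i) `v < 0` everywhere and the solution converges forward in time to a triple
collision equilibrium `(0, -√(2W(u_c))/|cos u_c|, u_c, 0)` with `u_c` a critical point of
the unregularized potential; or (ii) `v > 0` everywhere and the solution converges
backward in time to such an equilibrium with `+√(2W(u_c))/|cos u_c|`; or (iii) there is a
unique time `τ0` with `v(τ0) = 0`, `v < 0` before it, `v > 0` after it, and either
`s ≡ 0` or `s > 0` everywhere with its minimum over `ℝ` attained at `τ0`.  The three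
cases are mutually exclusive, so exactly one holds. -/
theorem stmt8 (m3 h : ℝ) (hm3 : 0 < m3) (hh : 0 ≤ h) (s v u w : ℝ → ℝ)
    (hsol : IsSolution m3 h s v u w) (hE : SatisfiesEnergy m3 h s v u w)
    (hs : ∀ τ : ℝ, 0 ≤ s τ ∧ s τ < 1) :
    ((∀ τ : ℝ, v τ < 0) ∧ ∃ uc : ℝ, Real.cos uc ≠ 0 ∧
        deriv (fun x => Wpot m3 x / Real.cos x ^ 2) uc = 0 ∧
        Tendsto (fun τ => (s τ, v τ, u τ, w τ)) atTop
          (nhds ((0 : ℝ), -Real.sqrt (2 * Wpot m3 uc) / |Real.cos uc|, uc, (0 : ℝ)))) ∨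
    ((∀ τ : ℝ, 0 < v τ) ∧ ∃ uc : ℝ, Real.cos uc ≠ 0 ∧
        deriv (fun x => Wpot m3 x / Real.cos x ^ 2) uc = 0 ∧
        Tendsto (fun τ => (s τ, v τ, u τ, w τ)) atBot
          (nhds ((0 : ℝ), Real.sqrt (2 * Wpot m3 uc) / |Real.cos uc|, uc, (0 : ℝ)))) ∨
    (∃ τ0 : ℝ, v τ0 = 0 ∧ (∀ τ : ℝ, v τ = 0 → τ = τ0) ∧
      (∀ τ : ℝ, τ < τ0 → v τ < 0) ∧ (∀ τ : ℝ, τ0 < τ → 0 < v τ) ∧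
      ((∀ τ : ℝ, s τ = 0) ∨ ((∀ τ : ℝ, 0 < s τ) ∧ ∀ τ : ℝ, s τ0 ≤ s τ))) := by
  have ⟨ds, dv, du, dw⟩ := hsol
  have hcont : ∀ {f f' : ℝ → ℝ}, (∀ t, HasDerivAt f (f' t) t) → Continuous f := fun hf =>
    continuous_iff_continuousAt.2 fun t => (hf t).continuousAt
  have hv0 : ∀ τ, v τ = 0 → 0 < 1 / 2 * (1 - s τ) * v τ ^ 2 * cos (u τ) ^ 2 + w τ ^ 2
      - (1 - s τ) * Wpot m3 (u τ) := fun τ h0 => by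
    have h1 := hE τ
    have h2 : 0 < (1 - s τ) * Wpot m3 (u τ) :=
      mul_pos (by linarith [(hs τ).2]) (Wpot_pos hm3 _)
    have h3 : 0 ≤ h * s τ * cos (u τ) ^ 2 :=
      mul_nonneg (mul_nonneg hh (hs τ).1) (sq_nonneg _)
    simp only [energyFn, h0] at h1 ⊢
    linarith
  by_cases hz : ∃ τ0, v τ0 = 0
  · obtain ⟨τ0, h0⟩ := hz
    have hafter : ∀ τ, τ0 < τ → 0 < v τ := fun τ hτ => pos_of_deriv_pos_of_eq_zero dv hv0 h0 hτ
    have hbefore : ∀ τ, τ < τ0 → v τ < 0 := fun τ hτ => by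
      have := pos_of_deriv_pos_of_eq_zero hsol.reverse.2.1
        (fun t ht => by
          have := hv0 (-t) (neg_eq_zero.1 ht)
          simpa only [neg_sq] using this)
        (a := -τ0) (t := -τ) (by simpa using h0) (by linarith)
      simpa using this
    refine Or.inr (Or.inr ⟨τ0, h0, fun τ hτ => ?_, hbefore, hafter, ?_⟩)
    · rcases lt_trichotomy τ τ0 with hlt | heq | hgt
      · exact absurd hτ (hbefore τ hlt).ne
      · exact heq
      · exact absurd hτ (hafter τ hgt).ne'
    have hg : Continuous fun τ => v τ * (1 - s τ) * cos (u τ) ^ 2 := by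
      have := hcont ds
      have := hcont dv
      have := hcont du
      fun_prop
    have hmul := exists_pos_mul_of_deriv_eq_mul hg
      (fun τ => (ds τ).congr_deriv (by ring)) τ0
    rcases (hs τ0).1.eq_or_lt with hs0 | hs0
    · left
      intro τ
      obtain ⟨k, -, hk⟩ := hmul τ
      rw [hk, ← hs0, mul_zero]
    · right
      refine ⟨fun τ => ?_, fun τ => ?_⟩
      · obtain ⟨k, hk0, hk⟩ := hmul τ
        rw [hk]
        positivity
      have hnn : ∀ x, 0 ≤ s x * (1 - s x) * cos (u x) ^ 2 := fun x =>
        mul_nonneg (mul_nonneg (hs x).1 (by linarith [(hs x).2])) (sq_nonneg _)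
      rcases le_total τ0 τ with hle | hle
      · refine monotoneOn_of_deriv_nonneg (convex_Ici τ0) (hcont ds).continuousOn
          (fun x _ => (ds x).differentiableAt.differentiableWithinAt) (fun x hx => ?_)
          Set.self_mem_Ici hle hle
        rw [interior_Ici] at hx
        rw [(ds x).deriv]
        nlinarith [mul_nonneg (hafter x hx).le (hnn x)]
      · refine antitoneOn_of_deriv_nonpos (convex_Iic τ0) (hcont ds).continuousOn
          (fun x _ => (ds x).differentiableAt.differentiableWithinAt) (fun x hx => ?_)
          hle Set.self_mem_Iic hle
        rw [interior_Iic] at hx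
        rw [(ds x).deriv]
        nlinarith [mul_nonneg (neg_nonneg.2 (hbefore x hx).le) (hnn x)]
  · push Not at hz
    have hsign : (∀ τ, v τ < 0) ∨ ∀ τ, 0 < v τ := by
      by_contra! hcon
      obtain ⟨⟨a, ha⟩, b, hb⟩ := hcon
      obtain ⟨c, hc⟩ := mem_range_of_exists_le_of_exists_ge (hcont dv) ⟨b, hb⟩ ⟨a, ha⟩
      exact hz c hc
    rcases hsign with hneg | hpos
    · exact Or.inl ⟨hneg, forward_triple_collision hm3 hh hsol hE hs hneg⟩
    · refine Or.inr (Or.inl ⟨hpos, ?_⟩)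
      obtain ⟨uc, h1, h2, h3⟩ := forward_triple_collision hm3 hh hsol.reverse hE.reverse
        (fun τ => hs (-τ)) (fun τ => neg_lt_zero.2 (hpos (-τ)))
      refine ⟨uc, h1, h2, ?_⟩
      have h4 := h3.comp tendsto_neg_atBot_atTop
      have hneg : Continuous fun p : ℝ × ℝ × ℝ × ℝ => (p.1, -p.2.1, p.2.2.1, -p.2.2.2) := by
        fun_prop
      have h5 := (hneg.tendsto _).comp h4
      simpa [Function.comp_def, neg_div] using h5
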